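/- Let f : (K,+) → GL₃(K) be an injective group homomorphism from the additive group of K such that every matrix f(b) is upper triangular and such that each matrix entry of f(b) is given by a fixed polynomial evaluated at b (i.e. there are polynomials P_{ij} ∈ K[X] with f(b)_{ij} = P_{ij}(b) for all b ∈ K). Then there exist α₁, α₂, α₃ ∈ K, not all zero, such that for all b ∈ K, f(b) is the matrix with rows (1, α₁b, α₂b + (α₁α₃/2)b²), (0, 1, α₃b), (0, 0, 1). -/

import Mathlib

open Matrix

open Polynomial in
/-- A polynomial `P` over an infinite domain with `P(b) P(-b) = 1` for all `b` is constant. -/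
theorem Polynomial.eval_eq_eval_zero_of_eval_mul_eval_neg_eq_one
    {K : Type*} [CommRing K] [IsDomain K] [Infinite K] (P : K[X])
    (h : ∀ b, P.eval b * P.eval (-b) = 1) (b : K) : P.eval b = P.eval 0 := by
  have hmul : P * P.comp (-X) = 1 := Polynomial.funext fun x => by simp [h]
  obtain ⟨c, -, rfl⟩ := Polynomial.isUnit_iff.mp (IsUnit.of_mul_eq_one _ hmul)
  simp

open Polynomial in
/-- In characteristic zero, an additive polynomial function is linear. -/
theorem Polynomial.eval_eq_coeff_one_mul_of_eval_add
    {K : Type*} [CommRing K] [IsDomain K] [CharZero K] (P : K[X])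
    (h : ∀ a b, P.eval (a + b) = P.eval a + P.eval b) (b : K) :
    P.eval b = P.coeff 1 * b := by
  have hcomp : P.comp (C 2 * X) = C 2 * P := Polynomial.funext fun x => by
    simp [two_mul, h]
  have hP : P = C (P.coeff 1) * X := by
    ext n
    by_cases hn : n = 1
    · simp [hn]
    · have hc := congrArg (fun Q => Q.coeff n) hcomp
      simp only [comp_C_mul_X_coeff, coeff_C_mul] at hc
      have hpow : (2 : K) ^ n ≠ 2 := by
        intro h2
        have h2' : 2 ^ n = 2 ^ 1 := by exact_mod_cast h2
        exact hn (Nat.pow_right_injective le_rfl h2')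
      have hz : ((2 : K) ^ n - 2) * P.coeff n = 0 := by linear_combination hc
      rw [(mul_eq_zero.mp hz).resolve_left (sub_ne_zero.mpr hpow)]
      simp [coeff_X, Ne.symm hn]
  conv_lhs => rw [hP]
  simp

/-- **Lemma 3.1 (Lemma `lem:Ga`).**
Let `K` be an algebraically closed field of characteristic `0` and let
`f : (K,+) → GL₃(K)` be an injective group homomorphism such that every matrix `f b` is
upper triangular and such that each matrix entry of `f b` is a fixed polynomial evaluated
at `b`.  Then there exist `α₁, α₂, α₃ ∈ K`, not all zero, with
`f b = !![1, α₁ b, α₂ b + (α₁α₃/2) b²; 0, 1, α₃ b; 0, 0, 1]` for all `b`. -/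
theorem upper_triangular_polynomial_rep_of_Ga
    {K : Type*} [Field K] [IsAlgClosed K] [CharZero K]
    (f : K → GL (Fin 3) K)
    (hinj : Function.Injective f)
    (hhom : ∀ b b' : K, f (b + b') = f b * f b')
    (htri : ∀ b : K, ∀ i j : Fin 3, j < i → (f b : Matrix (Fin 3) (Fin 3) K) i j = 0)
    (hpoly : ∃ P : Fin 3 → Fin 3 → Polynomial K,
      ∀ (b : K) (i j : Fin 3), (f b : Matrix (Fin 3) (Fin 3) K) i j = (P i j).eval b) :
    ∃ α₁ α₂ α₃ : K, ¬ (α₁ = 0 ∧ α₂ = 0 ∧ α₃ = 0) ∧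
      ∀ b : K, (f b : Matrix (Fin 3) (Fin 3) K) =
        !![1, α₁ * b, α₂ * b + (α₁ * α₃ / 2) * b ^ 2;
           0, 1,      α₃ * b;
           0, 0,      1] := by
  obtain ⟨P, hP⟩ := hpoly
  have hzero : f 0 = 1 := by simpa using hhom 0 0
  have hentry : ∀ a b i j, (P i j).eval (a + b) = ∑ k, (P i k).eval a * (P k j).eval b := by
    intro a b i j
    simp only [← hP, hhom, Units.val_mul, Matrix.mul_apply]
  have hlow : ∀ b i j, j < i → (P i j).eval b = 0 := fun b i j hij => by
    rw [← hP, htri b i j hij]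
  have h10 : ∀ b, (P 1 0).eval b = 0 := fun b => hlow b 1 0 (by decide)
  have h20 : ∀ b, (P 2 0).eval b = 0 := fun b => hlow b 2 0 (by decide)
  have h21 : ∀ b, (P 2 1).eval b = 0 := fun b => hlow b 2 1 (by decide)
  have hdiag0 : ∀ i, (P i i).eval 0 = 1 := fun i => by simp [← hP, hzero]
  have hdiag : ∀ i b, (P i i).eval b = 1 := by
    intro i b
    rw [← hdiag0 i]
    refine (P i i).eval_eq_eval_zero_of_eval_mul_eval_neg_eq_one (fun b => ?_) b
    have hb := hentry b (-b) i i
    rw [add_neg_cancel, hdiag0] at hb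
    fin_cases i <;> simpa [Fin.sum_univ_three, h10, h20, h21] using hb.symm
  have h01 := (P 0 1).eval_eq_coeff_one_mul_of_eval_add fun a b => by
    simp [hentry a b, Fin.sum_univ_three, hdiag, h21, add_comm]
  have h12 := (P 1 2).eval_eq_coeff_one_mul_of_eval_add fun a b => by
    simp [hentry a b, Fin.sum_univ_three, hdiag, h10, add_comm]
  set α₁ := (P 0 1).coeff 1
  set α₃ := (P 1 2).coeff 1
  set Q := P 0 2 - Polynomial.C (α₁ * α₃ / 2) * Polynomial.X ^ 2 with hQ
  have h02 := Q.eval_eq_coeff_one_mul_of_eval_add fun a b => by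
    simp only [hQ, Polynomial.eval_sub, Polynomial.eval_mul, Polynomial.eval_C,
      Polynomial.eval_pow, Polynomial.eval_X, hentry a b, Fin.sum_univ_three, hdiag, h01, h12]
    ring
  have hf : ∀ b : K, (f b : Matrix (Fin 3) (Fin 3) K) =
      !![1, α₁ * b, Q.coeff 1 * b + (α₁ * α₃ / 2) * b ^ 2;
         0, 1,      α₃ * b;
         0, 0,      1] := by
    intro b
    have h02' : (P 0 2).eval b = Q.coeff 1 * b + (α₁ * α₃ / 2) * b ^ 2 := by
      rw [← h02 b]
      simp [hQ]
    ext i j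
    rw [hP]
    fin_cases i <;> fin_cases j <;> simp [hdiag, h10, h20, h21, h01, h12, h02']
  refine ⟨α₁, Q.coeff 1, α₃, ?_, hf⟩
  rintro ⟨h1, h2, h3⟩
  refine one_ne_zero (hinj (Units.ext ?_) : (1 : K) = 0)
  rw [hf, hf, h1, h2, h3]
  simp
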